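/- Let (W,S) be a finite Coxeter system and σ a length-preserving automorphism of W (σ(S)=S). The irreducible characters of the fixed-point algebra Σ(W)^σ are in natural bijection with the σ-orbits on the set Λ of W-conjugacy classes of subsets of S: the map λ ↦ τ_λ^σ (restriction of τ_λ to Σ(W)^σ) induces a bijection Λ/σ ≅ Irr(Σ(W)^σ). -/

import Mathlib

open MonoidAlgebra

variable {B W : Type*} [DecidableEq B] [Fintype B] [Group W] [Fintype W] [DecidableEq W]

/-- `x_I`: the sum, in the group algebra `ℚW`, of the minimal length coset
representatives of the standard parabolic subgroup `W_I` in `W`, i.e. the sum of the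
`w ∈ W` such that `ws > w` for all `s ∈ I`. -/
noncomputable def descentBasis {M : CoxeterMatrix B} (cs : CoxeterSystem M W)
    (I : Finset B) : MonoidAlgebra ℚ W :=
  ∑ w : W, if ∀ i ∈ I, cs.length w < cs.length (w * cs.simple i)
    then MonoidAlgebra.single w (1 : ℚ) else 0

/-- `A` is the Solomon descent algebra `Σ(W)` of `(W,S)`: a subalgebra of the group
algebra `ℚW` whose underlying set is the span of the elements `x_I`, `I ⊆ S`.
(By Solomon's theorem this span is indeed closed under multiplication.) -/
def IsDescentAlgebra {M : CoxeterMatrix B} (cs : CoxeterSystem M W)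
    (A : Subalgebra ℚ (MonoidAlgebra ℚ W)) : Prop :=
  (A : Set (MonoidAlgebra ℚ W)) = Submodule.span ℚ (Set.range (descentBasis cs))

/-- The standard parabolic subgroup `W_I` generated by the simple reflections in `I`. -/
def parabolic {M : CoxeterMatrix B} (cs : CoxeterSystem M W) (I : Finset B) : Subgroup W :=
  Subgroup.closure (cs.simple '' I)


set_option linter.unusedSectionVars false
set_option linter.unusedVariables false

namespace DescAux

section cocycle

/-- The generator acting on `W × ZMod 2`. -/
def gen {M : CoxeterMatrix B} (cs : CoxeterSystem M W) (i : B) :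
    Function.End (W × ZMod 2) :=
  fun p => (cs.simple i * p.1 * cs.simple i, p.2 + if p.1 = cs.simple i then 1 else 0)

theorem simple_mul_pow {M : CoxeterMatrix B} (cs : CoxeterSystem M W) (i j : B) (k : ℕ) :
    (cs.simple i * cs.simple j) ^ k * cs.simple j * (cs.simple i * cs.simple j) ^ k
      = cs.simple j := by
  induction k with
  | zero => simp
  | succ k ih =>
    calc _ = (cs.simple i * cs.simple j) ^ k * (cs.simple i * (cs.simple j * cs.simple j)
          * cs.simple i) * cs.simple j * (cs.simple i * cs.simple j) ^ k := by
            rw [pow_succ]; nth_rw 2 [← pow_succ]; rw [pow_succ']; simp only [mul_assoc]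
      _ = _ := by simpa using ih

theorem gen_pow {M : CoxeterMatrix B} (cs : CoxeterSystem M W) (i j : B) (k : ℕ)
    (t : W) (ε : ZMod 2) :
    ((gen cs i * gen cs j) ^ k) (t, ε) =
      ((cs.simple i * cs.simple j) ^ k * t * ((cs.simple i * cs.simple j) ^ k)⁻¹,
        ε + ∑ l ∈ Finset.range (2 * k),
          if t = cs.simple j * (cs.simple i * cs.simple j) ^ l then 1 else 0) := by
  induction k with
  | zero => simp; rfl
  | succ k ih =>
    rw [pow_succ']
    change (gen cs i * gen cs j) (((gen cs i * gen cs j) ^ k) (t, ε)) = _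
    rw [ih]
    change gen cs i (gen cs j _) = _
    set r := cs.simple i * cs.simple j with hr
    have h1 := simple_mul_pow cs i j k
    rw [← hr] at h1
    have h2 : (r ^ k)⁻¹ * cs.simple j = cs.simple j * r ^ k := by
      rw [inv_mul_eq_iff_eq_mul, ← mul_assoc, h1]
    have key : ∀ u : W, r ^ k * t * (r ^ k)⁻¹ = cs.simple j * u ↔
        t = cs.simple j * (r ^ k * u * r ^ k) := by
      intro u
      rw [mul_inv_eq_iff_eq_mul, ← eq_inv_mul_iff_mul_eq, ← mul_assoc, ← mul_assoc, h2]
      simp only [mul_assoc]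
    have e1 : (r ^ k * t * (r ^ k)⁻¹ = cs.simple j) ↔ t = cs.simple j * r ^ (2 * k) := by
      have := key 1
      rw [mul_one, mul_one, ← pow_add, ← two_mul] at this
      exact this
    have e2 : (cs.simple j * (r ^ k * t * (r ^ k)⁻¹) * cs.simple j = cs.simple i) ↔
        t = cs.simple j * r ^ (2 * k + 1) := by
      have h := key r
      rw [← pow_succ, ← pow_add, show k + 1 + k = 2 * k + 1 by ring] at h
      rw [← h, hr]
      generalize (cs.simple i * cs.simple j) ^ k * t * ((cs.simple i * cs.simple j) ^ k)⁻¹ = q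
      constructor
      · intro h
        rw [← h]
        simp [mul_assoc]
      · intro h
        rw [h]
        simp [mul_assoc]
    simp only [gen, e1, e2]
    rw [show 2 * (k + 1) = 2 * k + 1 + 1 by ring, Finset.sum_range_succ, Finset.sum_range_succ]
    refine Prod.ext ?_ ?_
    · simp [pow_succ', mul_assoc, hr]
    · simp only [add_assoc]

theorem gen_liftable {M : CoxeterMatrix B} (cs : CoxeterSystem M W) :
    M.IsLiftable (gen cs) := by
  intro i j
  funext p
  obtain ⟨t, ε⟩ := p
  rw [gen_pow, cs.simple_mul_simple_pow, two_mul, Finset.sum_range_add]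
  simp only [pow_add, cs.simple_mul_simple_pow, one_mul, inv_one, mul_one]
  rw [CharTwo.add_self_eq_zero, add_zero]
  rfl

/-- The reflection cocycle: `rc w t = 1` iff `t` is a right inversion of `w`. -/
noncomputable def rc {M : CoxeterMatrix B} (cs : CoxeterSystem M W) (w t : W) : ZMod 2 :=
  (cs.lift ⟨gen cs, gen_liftable cs⟩ w (t, 0)).2

variable {M : CoxeterMatrix B} (cs : CoxeterSystem M W)

theorem lift_apply (w t : W) (ε : ZMod 2) :
    cs.lift ⟨gen cs, gen_liftable cs⟩ w (t, ε) = (w * t * w⁻¹, ε + rc cs w t) := by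
  induction w using cs.simple_induction_left generalizing t ε with
  | one =>
    have h : ∀ ε : ZMod 2, cs.lift ⟨gen cs, gen_liftable cs⟩ 1 (t, ε) = (t, ε) := by
      intro ε; rw [map_one]; rfl
    rw [rc, h, h]; simp
  | mul_simple_left w i ih =>
    have h : ∀ ε, cs.lift ⟨gen cs, gen_liftable cs⟩ (cs.simple i * w) (t, ε) =
        gen cs i (w * t * w⁻¹, ε + rc cs w t) := by
      intro ε
      rw [map_mul, cs.lift_apply_simple]
      change gen cs i _ = _
      rw [ih]
    have h0 : rc cs (cs.simple i * w) t = (gen cs i (w * t * w⁻¹, 0 + rc cs w t)).2 := by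
      unfold rc
      rw [h]
      rfl
    rw [h, h0]
    simp [gen, mul_assoc, add_assoc]

theorem rc_one (t : W) : rc cs 1 t = 0 := by
  simp [rc]; rfl

theorem rc_mul (x y t : W) : rc cs (x * y) t = rc cs y t + rc cs x (y * t * y⁻¹) := by
  have : cs.lift ⟨gen cs, gen_liftable cs⟩ (x * y) (t, 0) =
     cs.lift ⟨gen cs, gen_liftable cs⟩ x (cs.lift ⟨gen cs, gen_liftable cs⟩ y (t, 0)) := by
    rw [map_mul]; rfl
  rw [lift_apply, lift_apply, lift_apply] at this
  have := congrArg Prod.snd this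
  simpa using this

theorem rc_simple (i : B) (t : W) : rc cs (cs.simple i) t = if t = cs.simple i then 1 else 0 := by
  simp [rc, gen]

theorem rc_inv (a t : W) : rc cs a⁻¹ t = rc cs a (a⁻¹ * t * a) := by
  have h := rc_mul cs a a⁻¹ t
  rw [mul_inv_cancel, rc_one, inv_inv] at h
  exact CharTwo.add_eq_zero.mp h.symm

theorem rc_wordProd (ω : List B) (t : W) :
    rc cs (cs.wordProd ω) t = ((cs.rightInvSeq ω).count t : ZMod 2) := by
  induction ω with
  | nil => simp [rc_one]
  | cons i ω ih =>
    rw [cs.wordProd_cons, rc_mul, ih, rc_simple, CoxeterSystem.rightInvSeq, List.count_cons]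
    push_cast
    congr 1
    have : (cs.wordProd ω * t * (cs.wordProd ω)⁻¹ = cs.simple i) ↔
      ((cs.wordProd ω)⁻¹ * cs.simple i * cs.wordProd ω = t) := by
      constructor <;> (intro h; rw [← h]; group)
    simp [this]

/-- Exchange: a right inversion (cocycle sense) of a word can be deleted. -/
theorem exchange (ω : List B) (t : W) (h : rc cs (cs.wordProd ω) t = 1) :
    ∃ j, j < ω.length ∧ cs.wordProd ω * t = cs.wordProd (ω.eraseIdx j) := by
  rw [rc_wordProd] at h
  have hm : t ∈ cs.rightInvSeq ω := by
    by_contra hn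
    rw [List.count_eq_zero_of_not_mem hn] at h
    simp at h
  obtain ⟨j, hj, rfl⟩ := List.mem_iff_getElem.mp hm
  refine ⟨j, by simpa using hj, ?_⟩
  rw [← List.getD_eq_getElem _ 1 hj, cs.wordProd_mul_getD_rightInvSeq]

theorem length_lt_of_rc (w t : W) (h : rc cs w t = 1) : cs.length (w * t) < cs.length w := by
  obtain ⟨ω, hω, rfl⟩ := cs.exists_isReduced w
  obtain ⟨j, hj, e⟩ := exchange cs ω t h
  rw [e]
  calc _ ≤ (ω.eraseIdx j).length := cs.length_wordProd_le _
      _ < ω.length := by rw [← List.length_eraseIdx_add_one hj]; exact lt_add_one _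
      _ = _ := hω.symm

theorem zmod2 (x : ZMod 2) : x = 0 ∨ x = 1 := by
  revert x; decide

theorem rc_simple_iff (w : W) (i : B) :
    rc cs w (cs.simple i) = 0 ↔ cs.length w < cs.length (w * cs.simple i) := by
  constructor
  · intro h
    have h2 : rc cs (w * cs.simple i) (cs.simple i) = 1 := by
      rw [rc_mul, rc_simple]
      simp [h]
    have := length_lt_of_rc cs _ _ h2
    simpa using this
  · intro h
    rcases zmod2 (rc cs w (cs.simple i)) with h0 | h1
    · exact h0
    · have := length_lt_of_rc cs _ _ h1
      omega

end cocycle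

section injective

open Real

variable {M : CoxeterMatrix B}

/-- The Cartan type matrix of the geometric representation. -/
noncomputable def cart (M : CoxeterMatrix B) (i j : B) : ℝ := -2 * cos (π / M i j)

/-- The coroots of the geometric representation. -/
noncomputable def coroot (M : CoxeterMatrix B) (i : B) : Module.Dual ℝ (B → ℝ) :=
  ∑ j, cart M i j • LinearMap.proj j

theorem coroot_single (M : CoxeterMatrix B) (i j : B) :
    coroot M i (Pi.single j 1) = cart M i j := by
  simp [coroot, Pi.single_apply]

theorem coroot_self (M : CoxeterMatrix B) (i : B) : coroot M i (Pi.single i 1) = 2 := by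
  rw [coroot_single, cart, M.diagonal]; simp

theorem S_cos (θ : ℝ) (n : ℤ) :
    (Polynomial.Chebyshev.S ℝ n).eval (2 * cos θ) * sin θ = sin ((n + 1) * θ) := by
  have := Polynomial.Chebyshev.U_real_cos θ n
  rw [← this, Polynomial.Chebyshev.S_eq_U_comp_half_mul_X]
  simp

theorem refl_liftable (M : CoxeterMatrix B) :
    M.IsLiftable (fun i => Module.reflection (coroot_self M i)) := by
  intro i j
  rcases eq_or_ne i j with rfl | hij
  · rw [M.diagonal, pow_one]
    ext1 v
    exact Module.involutive_reflection (coroot_self M i) v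
  · ext1 z
    rw [Module.reflection_mul_reflection_pow_apply _ _ _ _ (2 * cos (2 * (π / M i j))) (by
      rw [coroot_single, coroot_single, cart, cart, M.symmetric j i, cos_two_mul]; ring)]
    have hm1 : M i j ≠ 1 := M.off_diagonal i j hij
    obtain hm0 | hm2 | hm3 : M i j = 0 ∨ M i j = 2 ∨ 3 ≤ M i j := by omega
    · simp [hm0]
    · rw [coroot_single, coroot_single, cart, cart, M.symmetric j i, hm2]
      have e : 2 * cos (2 * (π / ((2 : ℕ) : ℝ))) = -2 := by
        rw [show 2 * (π / ((2 : ℕ) : ℝ)) = π by push_cast; ring, cos_pi]; ring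
      rw [e]
      simp
      module
    · set m := M i j with hm
      have hmpos : (0:ℝ) < m := by positivity
      set θ := 2 * (π / m) with hθ
      have hs : sin θ ≠ 0 := by
        apply ne_of_gt
        apply sin_pos_of_pos_of_lt_pi
        · positivity
        · rw [hθ, ← mul_div_assoc, div_lt_iff₀ hmpos]
          have : (3:ℝ) ≤ m := by exact_mod_cast hm3
          nlinarith [pi_pos]
      rcases Nat.even_or_odd' m with ⟨k, hk | hk⟩
      · have h0 : (Polynomial.Chebyshev.S ℝ ((k:ℤ) - 1)).eval (2 * cos θ) = 0 := by
          have h := S_cos θ (k - 1)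
          have e : (((k:ℤ) - 1 : ℤ) + 1 : ℝ) * θ = π := by
            rw [hθ]
            have : (m:ℝ) = 2 * k := by exact_mod_cast hk
            push_cast
            field_simp
            rw [this]; ring
          rw [e, sin_pi] at h
          exact (mul_eq_zero.mp h).resolve_right hs
        have e1 : ((m:ℤ) - 2) / 2 = k - 1 := by omega
        have e2 : ((m:ℤ) - 1) / 2 = k - 1 := by omega
        rw [e1, e2, h0]; simp
      · have h0 : (Polynomial.Chebyshev.S ℝ (k:ℤ)).eval (2 * cos θ) +
            (Polynomial.Chebyshev.S ℝ ((k:ℤ) - 1)).eval (2 * cos θ) = 0 := by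
          have h := S_cos θ (k - 1)
          have h' := S_cos θ k
          have e : (((k:ℤ) - 1 : ℤ) + 1 : ℝ) * θ = 2 * π - ((k : ℤ) + 1) * θ := by
            rw [hθ]
            have : (m:ℝ) = 2 * k + 1 := by exact_mod_cast hk
            push_cast
            field_simp
            rw [this]; ring
          rw [e, sin_two_pi_sub, ← h'] at h
          have h2 : ((Polynomial.Chebyshev.S ℝ (k:ℤ)).eval (2 * cos θ) +
            (Polynomial.Chebyshev.S ℝ ((k:ℤ) - 1)).eval (2 * cos θ)) * sin θ = 0 := by
            linear_combination h
          exact (mul_eq_zero.mp h2).resolve_right hs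
        have e1 : ((m:ℤ) - 2) / 2 = k - 1 := by omega
        have e2 : ((m:ℤ) - 1) / 2 = k := by omega
        have e3 : ((m:ℤ) - 3) / 2 = k - 1 := by omega
        have e4 : (m:ℤ) / 2 = k := by omega
        rw [e1, e2, e3, e4, h0]; simp

theorem simple_injective (cs : CoxeterSystem M W) : Function.Injective cs.simple := by
  intro i j h
  by_contra hij
  have h2 : (cs.lift ⟨_, refl_liftable M⟩ (cs.simple i)) (Pi.single i 1) =
    (cs.lift ⟨_, refl_liftable M⟩ (cs.simple j)) (Pi.single i 1) := by rw [h]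
  rw [cs.lift_apply_simple, cs.lift_apply_simple, Module.reflection_apply,
    Module.reflection_apply, coroot_self] at h2
  have h3 := congrFun h2 i
  simp [hij] at h3

end injective

section parabolic

variable {M : CoxeterMatrix B} (cs : CoxeterSystem M W)

theorem simple_mem (I : Finset B) {i : B} (hi : i ∈ I) : cs.simple i ∈ parabolic cs I :=
  Subgroup.subset_closure ⟨i, by simpa using hi, rfl⟩

theorem rc_parabolic (I : Finset B) (u : W) (hu : u ∈ parabolic cs I) :
    ∀ t, t ∉ parabolic cs I → rc cs u t = 0 := by
  induction hu using Subgroup.closure_induction with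
  | mem x hx =>
    obtain ⟨i, hi, rfl⟩ := hx
    intro t ht
    rw [rc_simple, if_neg]
    rintro rfl
    exact ht (simple_mem cs I (by simpa using hi))
  | one => intro t _; exact rc_one cs t
  | mul x y hx hy ihx ihy =>
    intro t ht
    rw [rc_mul, ihy t ht, ihx, add_zero]
    intro h
    apply ht
    have := (parabolic cs I).mul_mem ((parabolic cs I).mul_mem ((parabolic cs I).inv_mem hy) h) hy
    simpa [mul_assoc] using this
  | inv x hx ih =>
    intro t ht
    rw [rc_inv]
    apply ih
    intro h
    apply ht
    have := (parabolic cs I).mul_mem ((parabolic cs I).mul_mem hx h) ((parabolic cs I).inv_mem hx)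
    simpa [mul_assoc] using this

theorem exists_word (I : Finset B) (u : W) (hu : u ∈ parabolic cs I) :
    ∃ ω : List B, (∀ i ∈ ω, i ∈ I) ∧ cs.wordProd ω = u := by
  induction hu using Subgroup.closure_induction with
  | mem x hx =>
    obtain ⟨i, hi, rfl⟩ := hx
    exact ⟨[i], by simpa using hi, by simp⟩
  | one => exact ⟨[], by simp, by simp⟩
  | mul x y hx hy ihx ihy =>
    obtain ⟨ω, h1, rfl⟩ := ihx
    obtain ⟨ω', h1', rfl⟩ := ihy
    refine ⟨ω ++ ω', ?_, cs.wordProd_append _ _⟩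
    intro i hi
    rcases List.mem_append.mp hi with h | h
    · exact h1 i h
    · exact h1' i h
  | inv x hx ih =>
    obtain ⟨ω, h1, rfl⟩ := ih
    exact ⟨ω.reverse, by simpa using h1, cs.wordProd_reverse _⟩

theorem word_eq_one (I : Finset B) (n : ℕ) : ∀ ω : List B, ω.length = n → (∀ i ∈ ω, i ∈ I) →
    (∀ i ∈ I, rc cs (cs.wordProd ω) (cs.simple i) = 0) → cs.wordProd ω = 1 := by
  induction n using Nat.strong_induction_on with
  | _ n ih =>
    intro ω hn hI hr
    rcases List.eq_nil_or_concat ω with rfl | ⟨ω', i, rfl⟩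
    · simp
    · have hi : i ∈ I := hI i (by simp)
      have h := hr i hi
      rw [cs.wordProd_concat, rc_mul, rc_simple, if_pos rfl] at h
      have e : cs.simple i * cs.simple i * (cs.simple i)⁻¹ = cs.simple i := by group
      rw [e] at h
      have h1 : rc cs (cs.wordProd ω') (cs.simple i) = 1 := by
        rcases zmod2 (rc cs (cs.wordProd ω') (cs.simple i)) with h0 | h0
        · rw [h0] at h; simp at h
        · exact h0
      obtain ⟨j, hj, e2⟩ := exchange cs ω' _ h1
      rw [cs.wordProd_concat, e2] at hr ⊢
      refine ih _ ?_ _ rfl ?_ hr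
      · rw [← hn, List.length_concat]
        have := List.length_eraseIdx_add_one hj
        omega
      · intro k hk
        exact hI k (by simp [List.mem_of_mem_eraseIdx hk])

theorem eq_one_of_rc (I : Finset B) (u : W) (hu : u ∈ parabolic cs I)
    (h : ∀ i ∈ I, rc cs u (cs.simple i) = 0) : u = 1 := by
  obtain ⟨ω, h1, rfl⟩ := exists_word cs I u hu
  exact word_eq_one cs I _ ω rfl h1 h

/-- membership in `X_I`. -/
def InX (I : Finset B) (w : W) : Prop := ∀ i ∈ I, rc cs w (cs.simple i) = 0

theorem inX_iff (I : Finset B) (w : W) :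
    (∀ i ∈ I, cs.length w < cs.length (w * cs.simple i)) ↔ InX cs I w := by
  simp only [InX, rc_simple_iff]

theorem exists_min (I : Finset B) (w : W) :
    ∃ v ∈ parabolic cs I, ∀ t ∈ parabolic cs I, rc cs (w * v) t = 0 := by
  classical
  obtain ⟨v, hv, hmin⟩ := Finset.exists_min_image
    (Finset.univ.filter (fun v => v ∈ parabolic cs I)) (fun v => cs.length (w * v))
    ⟨1, by simp [(parabolic cs I).one_mem]⟩
  simp only [Finset.mem_filter, Finset.mem_univ, true_and] at hv hmin
  refine ⟨v, hv, fun t ht => ?_⟩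
  rcases zmod2 (rc cs (w * v) t) with h | h
  · exact h
  · have h1 := length_lt_of_rc cs _ _ h
    have h2 := hmin (v * t) ((parabolic cs I).mul_mem hv ht)
    rw [← mul_assoc] at h2
    omega

theorem rc_of_inX (I : Finset B) (a : W) (ha : InX cs I a) (t : W) (ht : t ∈ parabolic cs I) :
    rc cs a t = 0 := by
  obtain ⟨v, hv, h⟩ := exists_min cs I a
  have h1 : v⁻¹ = 1 := by
    refine eq_one_of_rc cs I _ ((parabolic cs I).inv_mem hv) fun i hi => ?_
    have h2 := ha i hi
    rw [show a = (a * v) * v⁻¹ by group, rc_mul, h, add_zero] at h2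
    · exact h2
    · exact (parabolic cs I).mul_mem ((parabolic cs I).mul_mem ((parabolic cs I).inv_mem hv)
        (simple_mem cs I hi)) ((parabolic cs I).inv_mem ((parabolic cs I).inv_mem hv))
  have h3 : v = 1 := by simpa using h1
  subst h3
  simpa using h t ht

theorem inX_unique (I : Finset B) (a u : W) (ha : InX cs I a) (hu : u ∈ parabolic cs I)
    (hau : InX cs I (a * u)) : u = 1 := by
  refine eq_one_of_rc cs I _ hu fun i hi => ?_
  have h := hau i hi
  rw [rc_mul, rc_of_inX cs I a ha, add_zero] at h
  · exact h
  · exact (parabolic cs I).mul_mem ((parabolic cs I).mul_mem hu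
        (simple_mem cs I hi)) ((parabolic cs I).inv_mem hu)

theorem exists_inX (I : Finset B) (w : W) : ∃ v ∈ parabolic cs I, InX cs I (w * v) := by
  obtain ⟨v, hv, h⟩ := exists_min cs I w
  exact ⟨v, hv, fun i hi => h _ (simple_mem cs I hi)⟩

theorem simple_mem_iff (I : Finset B) (i : B) : cs.simple i ∈ parabolic cs I ↔ i ∈ I := by
  refine ⟨fun h => ?_, simple_mem cs I⟩
  by_contra hi
  have h1 : cs.simple i = 1 := by
    refine eq_one_of_rc cs I _ h fun j hj => ?_
    rw [rc_simple, if_neg]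
    intro e
    exact hi (simple_injective cs e ▸ hj)
  have := cs.length_simple i
  rw [h1] at this
  simp at this

theorem exists_descent (E : Finset B) : ∃ w : W, ∀ i, rc cs w (cs.simple i) = 0 ↔ i ∉ E := by
  classical
  obtain ⟨v, hv, hmax⟩ := Finset.exists_max_image
    (Finset.univ.filter (fun v => v ∈ parabolic cs E)) (fun v => cs.length v)
    ⟨1, by simp [(parabolic cs E).one_mem]⟩
  simp only [Finset.mem_filter, Finset.mem_univ, true_and] at hv hmax
  refine ⟨v, fun i => ?_⟩
  constructor
  · intro h hi
    rw [rc_simple_iff] at h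
    have := hmax _ ((parabolic cs E).mul_mem hv (simple_mem cs E hi))
    omega
  · intro hi
    exact rc_parabolic cs E v hv _ (by rwa [simple_mem_iff])

end parabolic

section product

variable {M : CoxeterMatrix B} (cs : CoxeterSystem M W)

open Classical in
theorem coeff_descentBasis (I : Finset B) (w : W) :
    (descentBasis cs I).coeff w = if InX cs I w then 1 else 0 := by
  rw [descentBasis, MonoidAlgebra.coeff_sum, Finset.sum_apply']
  rw [Finset.sum_eq_single w]
  · simp only [inX_iff]
    split_ifs <;> simp
  · intro b _ hb
    split_ifs <;> simp [hb]
  · simp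

theorem smul_mk_eq_iff (I : Finset B) (s c : W) :
    s • (QuotientGroup.mk c : W ⧸ parabolic cs I) = QuotientGroup.mk c ↔
      c⁻¹ * s * c ∈ parabolic cs I := by
  change (QuotientGroup.mk (s * c) : W ⧸ parabolic cs I) = QuotientGroup.mk c ↔ _
  rw [eq_comm, QuotientGroup.eq, mul_assoc]

theorem descent_key (I : Finset B) (w a : W) (ha : InX cs I a) (s : W) :
    (s • (QuotientGroup.mk (w⁻¹ * a) : W ⧸ parabolic cs I) = QuotientGroup.mk (w⁻¹ * a) →
      rc cs (a⁻¹ * w) s = rc cs w s) ∧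
    (s • (QuotientGroup.mk (w⁻¹ * a) : W ⧸ parabolic cs I) ≠ QuotientGroup.mk (w⁻¹ * a) →
      rc cs (a⁻¹ * w) s = rc cs ((QuotientGroup.mk (w⁻¹ * a) : W ⧸ parabolic cs I).out)⁻¹ s) := by
  constructor
  · intro h
    rw [smul_mk_eq_iff] at h
    rw [rc_mul, rc_inv, rc_of_inX cs I a ha, add_zero]
    convert h using 1
    group
  · intro h
    rw [Ne, smul_mk_eq_iff] at h
    obtain ⟨u, hu⟩ := QuotientGroup.mk_out_eq_mul (parabolic cs I) (w⁻¹ * a)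
    rw [hu, mul_inv_rev, rc_mul cs (u : W)⁻¹, rc_parabolic cs I (u : W)⁻¹ ((parabolic cs I).inv_mem u.2), add_zero]
    · congr 1; group
    · convert h using 2
      group

/-- weakly positive cosets -/
def Pos (I J : Finset B) (F : W ⧸ parabolic cs I) : Prop :=
  ∀ i ∈ J, cs.simple i • F ≠ F → rc cs (F.out)⁻¹ (cs.simple i) = 0

open Classical in
/-- the walls containing a coset -/
noncomputable def wall (I J : Finset B) (F : W ⧸ parabolic cs I) : Finset B :=
  J.filter (fun i => cs.simple i • F = F)

open Classical in
theorem mul_formula (I J : Finset B) :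
    descentBasis cs I * descentBasis cs J =
      ∑ F : W ⧸ parabolic cs I, if Pos cs I J F then descentBasis cs (wall cs I J F) else 0 := by
  apply MonoidAlgebra.coeff_injective
  ext w
  have h1 : (descentBasis cs I * descentBasis cs J).coeff w =
      ∑ a ∈ Finset.univ.filter (fun a => InX cs I a),
        if InX cs J (a⁻¹ * w) then (1 : ℚ) else 0 := by
    conv_lhs => rw [descentBasis, Finset.sum_mul, MonoidAlgebra.coeff_sum, Finset.sum_apply']
    rw [Finset.sum_filter]
    refine Finset.sum_congr rfl fun a _ => ?_
    simp only [inX_iff]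
    split_ifs with h2 h3
    · rw [MonoidAlgebra.coeff_single_mul_apply, coeff_descentBasis, if_pos h3]; simp
    · rw [MonoidAlgebra.coeff_single_mul_apply, coeff_descentBasis, if_neg h3]; simp
    · simp
  rw [h1, MonoidAlgebra.coeff_sum, Finset.sum_apply']
  refine Finset.sum_bij (fun a _ => (QuotientGroup.mk (w⁻¹ * a) : W ⧸ parabolic cs I)) ?_ ?_ ?_ ?_
  · intros; exact Finset.mem_univ _
  · intro a ha b hb hab
    simp only [Finset.mem_filter, Finset.mem_univ, true_and] at ha hb
    rw [QuotientGroup.eq] at hab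
    have hu : a⁻¹ * b ∈ parabolic cs I := by
      convert hab using 1; group
    have := inX_unique cs I a (a⁻¹ * b) ha hu (by simpa using hb)
    exact (inv_mul_eq_one.mp this)
  · intro F _
    obtain ⟨c, rfl⟩ := QuotientGroup.mk_surjective F
    obtain ⟨v, hv, hx⟩ := exists_inX cs I (w * c)
    refine ⟨w * c * v, by simpa using hx, ?_⟩
    rw [eq_comm, QuotientGroup.eq]
    convert hv using 1; group
  · intro a ha
    simp only [Finset.mem_filter, Finset.mem_univ, true_and] at ha
    generalize hF : (QuotientGroup.mk (w⁻¹ * a) : W ⧸ parabolic cs I) = F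
    have key : InX cs J (a⁻¹ * w) ↔ Pos cs I J F ∧ InX cs (wall cs I J F) w := by
      have hk := fun s => descent_key cs I w a ha s
      rw [hF] at hk
      constructor
      · intro h
        refine ⟨fun i hi hne => ?_, fun i hi => ?_⟩
        · rw [← (hk _).2 hne]; exact h i hi
        · obtain ⟨hi, he⟩ := Finset.mem_filter.mp hi
          rw [← (hk _).1 he]; exact h i hi
      · rintro ⟨h1, h2⟩ i hi
        by_cases he : cs.simple i • F = F
        · rw [(hk _).1 he]; exact h2 i (Finset.mem_filter.mpr ⟨hi, he⟩)
        · rw [(hk _).2 he]; exact h1 i hi he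
    simp only [key]
    by_cases hp : Pos cs I J F
    · simp [hp, coeff_descentBasis]
    · simp [hp]

/-- number of `W_J`-fixed points on `W/W_I`. -/
noncomputable def mfix (I J : Finset B) : ℕ :=
  Nat.card {F : W ⧸ parabolic cs I // ∀ x ∈ parabolic cs J, x • F = F}

/-- strictly lower span -/
noncomputable def low (J : Finset B) : Submodule ℚ (MonoidAlgebra ℚ W) :=
  Submodule.span ℚ (descentBasis cs '' {K | K ⊂ J})

theorem fix_iff (I J : Finset B) (F : W ⧸ parabolic cs I) :
    (∀ x ∈ parabolic cs J, x • F = F) ↔ ∀ i ∈ J, cs.simple i • F = F := by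
  constructor
  · intro h i hi; exact h _ (simple_mem cs J hi)
  · intro h x hx
    have : parabolic cs J ≤ MulAction.stabilizer W F := by
      rw [parabolic, Subgroup.closure_le]
      rintro _ ⟨i, hi, rfl⟩
      exact h i (by simpa using hi)
    exact this hx

theorem mul_basis_sub (I J : Finset B) :
    descentBasis cs I * descentBasis cs J - (mfix cs I J : ℚ) • descentBasis cs J ∈ low cs J := by
  classical
  have h : (mfix cs I J : ℚ) • descentBasis cs J =
      ∑ F : W ⧸ parabolic cs I, if (∀ i ∈ J, cs.simple i • F = F) then descentBasis cs J else 0 := by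
    rw [← Finset.sum_filter, Finset.sum_const, mfix, Nat.card_eq_fintype_card,
      Fintype.card_subtype]
    simp only [fix_iff]
    rw [Nat.cast_smul_eq_nsmul]
  rw [h, mul_formula, ← Finset.sum_sub_distrib]
  refine Submodule.sum_mem _ fun F _ => ?_
  by_cases hF : ∀ i ∈ J, cs.simple i • F = F
  · have hp : Pos cs I J F := fun i hi hne => absurd (hF i hi) hne
    have hw : wall cs I J F = J := Finset.filter_true_of_mem hF
    rw [if_pos hp, if_pos hF, hw, sub_self]
    exact Submodule.zero_mem _
  · rw [if_neg hF, sub_zero]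
    split_ifs with hp
    · apply Submodule.subset_span
      refine ⟨_, ?_, rfl⟩
      refine (Finset.filter_subset _ _).ssubset_of_ne ?_
      intro he
      exact hF (Finset.filter_eq_self.mp he)
    · exact Submodule.zero_mem _

theorem basis_notMem (J : Finset B) : descentBasis cs J ∉ low cs J := by
  classical
  intro hmem
  choose d hd using exists_descent cs
  let φ : MonoidAlgebra ℚ W →ₗ[ℚ] ℚ :=
    { toFun := fun x => ∑ E ∈ J.powerset, (-1 : ℚ) ^ E.card * x.coeff (d E)
      map_add' := by
        intro x y
        simp [mul_add, Finset.sum_add_distrib]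
      map_smul' := by
        intro c x
        simp only [MonoidAlgebra.coeff_smul, Finsupp.smul_apply, smul_eq_mul, RingHom.id_apply,
          Finset.mul_sum]
        refine Finset.sum_congr rfl fun E _ => ?_
        ring }
  have hφ : ∀ K, φ (descentBasis cs K) = ∑ E ∈ (J \ K).powerset, (-1 : ℚ) ^ E.card := by
    intro K
    change ∑ E ∈ J.powerset, (-1 : ℚ) ^ E.card * (descentBasis cs K).coeff (d E) = _
    simp only [coeff_descentBasis, mul_ite, mul_one, mul_zero]
    rw [← Finset.sum_filter]
    refine Finset.sum_congr ?_ fun _ _ => rfl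
    ext E
    simp only [Finset.mem_filter, Finset.mem_powerset, InX, hd, Finset.subset_sdiff,
      Finset.disjoint_right]
  have hlow : low cs J ≤ LinearMap.ker φ := by
    rw [low, Submodule.span_le]
    rintro _ ⟨K, hK, rfl⟩
    change φ _ = 0
    rw [hφ]
    have h := Finset.sum_powerset_neg_one_pow_card_of_nonempty
      (x := J \ K) (Finset.sdiff_nonempty.mpr hK.2)
    exact_mod_cast h
  have h0 : φ (descentBasis cs J) = 0 := hlow hmem
  rw [hφ] at h0
  simp at h0

theorem basis_univ : descentBasis cs (Finset.univ : Finset B) = 1 := by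
  classical
  apply MonoidAlgebra.coeff_injective
  ext w
  rw [coeff_descentBasis, MonoidAlgebra.one_def, MonoidAlgebra.coeff_single]
  have : InX cs Finset.univ w ↔ w = 1 := by
    constructor
    · intro h
      by_contra hw
      obtain ⟨i, hi⟩ := cs.exists_rightDescent_of_ne_one hw
      have h1 := (rc_simple_iff cs w i).mp (h i (Finset.mem_univ i))
      unfold CoxeterSystem.IsRightDescent at hi
      omega
    · rintro rfl i _
      exact rc_one cs _
  simp [this, Finsupp.single_apply, eq_comm]


theorem low_mono {K J : Finset B} (h : K ⊆ J) : low cs K ≤ low cs J := by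
  apply Submodule.span_mono
  apply Set.image_mono
  intro L hL
  exact lt_of_lt_of_le hL h

theorem basis_mem_low {K J : Finset B} (h : K ⊂ J) : descentBasis cs K ∈ low cs J :=
  Submodule.subset_span ⟨K, h, rfl⟩

theorem basis_mul_low (I J : Finset B) (v : MonoidAlgebra ℚ W) (hv : v ∈ low cs J) :
    descentBasis cs I * v ∈ low cs J := by
  unfold low at hv
  induction hv using Submodule.span_induction with
  | mem x hx =>
    obtain ⟨K, hK, rfl⟩ := hx
    have h1 := low_mono cs hK.1 (mul_basis_sub cs I K)
    have h2 := (low cs J).smul_mem (mfix cs I K : ℚ) (basis_mem_low cs hK)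
    have := (low cs J).add_mem h1 h2
    simpa using this
  | zero => simp
  | add x y _ _ hx hy => rw [mul_add]; exact Submodule.add_mem _ hx hy
  | smul c x _ hx => rw [mul_smul_comm]; exact Submodule.smul_mem _ _ hx

theorem span_mul_low (J : Finset B) (a v : MonoidAlgebra ℚ W)
    (ha : a ∈ Submodule.span ℚ (Set.range (descentBasis cs))) (hv : v ∈ low cs J) :
    a * v ∈ low cs J := by
  induction ha using Submodule.span_induction with
  | mem x hx => obtain ⟨I, rfl⟩ := hx; exact basis_mul_low cs I J v hv
  | zero => simp
  | add x y _ _ hx hy => rw [add_mul]; exact Submodule.add_mem _ hx hy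
  | smul c x _ hx => rw [smul_mul_assoc]; exact Submodule.smul_mem _ _ hx

/-- existence of common eigenvalues -/
theorem exists_eig (J K : Finset B) (hJK : ∀ I, mfix cs I J = mfix cs I K) (a : MonoidAlgebra ℚ W)
    (ha : a ∈ Submodule.span ℚ (Set.range (descentBasis cs))) :
    ∃ c : ℚ, a * descentBasis cs J - c • descentBasis cs J ∈ low cs J ∧
      a * descentBasis cs K - c • descentBasis cs K ∈ low cs K := by
  induction ha using Submodule.span_induction with
  | mem x hx =>
    obtain ⟨I, rfl⟩ := hx
    exact ⟨mfix cs I J, mul_basis_sub cs I J, by rw [hJK]; exact mul_basis_sub cs I K⟩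
  | zero => exact ⟨0, by simp, by simp⟩
  | add x y _ _ hx hy =>
    obtain ⟨c, h1, h2⟩ := hx
    obtain ⟨d, h3, h4⟩ := hy
    refine ⟨c + d, ?_, ?_⟩
    · convert Submodule.add_mem _ h1 h3 using 1
      rw [add_mul, add_smul]; abel
    · convert Submodule.add_mem _ h2 h4 using 1
      rw [add_mul, add_smul]; abel
  | smul q x _ hx =>
    obtain ⟨c, h1, h2⟩ := hx
    refine ⟨q * c, ?_, ?_⟩
    · convert Submodule.smul_mem _ q h1 using 1
      rw [smul_sub, smul_mul_assoc, mul_smul]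
    · convert Submodule.smul_mem _ q h2 using 1
      rw [smul_sub, smul_mul_assoc, mul_smul]

theorem eig_unique (J : Finset B) (y : MonoidAlgebra ℚ W) (c d : ℚ)
    (hc : y - c • descentBasis cs J ∈ low cs J)
    (hd : y - d • descentBasis cs J ∈ low cs J) : c = d := by
  by_contra h
  have h1 := Submodule.sub_mem _ hd hc
  have h2 : (c - d) • descentBasis cs J ∈ low cs J := by
    convert h1 using 1
    rw [sub_smul]; abel
  rw [Submodule.smul_mem_iff _ (sub_ne_zero.mpr h)] at h2
  exact basis_notMem cs J h2

theorem exists_hom (A' : Subalgebra ℚ (MonoidAlgebra ℚ W))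
    (hA' : ∀ a ∈ A', a ∈ Submodule.span ℚ (Set.range (descentBasis cs))) (J : Finset B) :
    ∃ t : A' →ₐ[ℚ] ℚ, ∀ a : A', (a : MonoidAlgebra ℚ W) * descentBasis cs J -
      (t a) • descentBasis cs J ∈ low cs J := by
  have hex : ∀ a : A', ∃ c : ℚ, (a : MonoidAlgebra ℚ W) * descentBasis cs J -
      c • descentBasis cs J ∈ low cs J := fun a => by
    obtain ⟨c, h, _⟩ := exists_eig cs J J (fun _ => rfl) a (hA' a a.2)
    exact ⟨c, h⟩
  choose f hf using hex
  have huniq : ∀ a : A', ∀ d : ℚ, (a : MonoidAlgebra ℚ W) * descentBasis cs J -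
      d • descentBasis cs J ∈ low cs J → f a = d := fun a d hd =>
    eig_unique cs J _ _ _ (hf a) hd
  have hadd : ∀ a b, f (a + b) = f a + f b := by
    intro a b
    apply huniq
    convert Submodule.add_mem _ (hf a) (hf b) using 1
    push_cast
    rw [add_mul, add_smul]; abel
  have hmul : ∀ a b, f (a * b) = f a * f b := by
    intro a b
    apply huniq
    have h1 := span_mul_low cs J a _ (hA' a a.2) (hf b)
    have h2 := Submodule.smul_mem _ (f b) (hf a)
    convert Submodule.add_mem _ h1 h2 using 1
    push_cast
    rw [mul_sub, smul_sub, mul_smul_comm, smul_smul, mul_assoc, mul_comm (f b)]; abel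
  have halg : ∀ r : ℚ, f (algebraMap ℚ A' r) = r := by
    intro r
    apply huniq
    have : ((algebraMap ℚ A' r : A') : MonoidAlgebra ℚ W) = algebraMap ℚ _ r := rfl
    rw [this, ← Algebra.smul_def, sub_self]
    exact Submodule.zero_mem _
  refine ⟨{ toFun := f, map_one' := ?_, map_mul' := hmul, map_zero' := ?_, map_add' := hadd,
            commutes' := halg }, hf⟩
  · simpa using halg 1
  · simpa using halg 0

theorem nilp (b : MonoidAlgebra ℚ W)
    (hs : ∀ J v, v ∈ low cs J → b * v ∈ low cs J)
    (hb : ∀ J, b * descentBasis cs J ∈ low cs J) (n : ℕ) :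
    ∀ J : Finset B, J.card < n → b ^ n * descentBasis cs J = 0 := by
  induction n with
  | zero => intro J h; omega
  | succ n ih =>
    intro J hJ
    rw [pow_succ, mul_assoc]
    have h : ∀ v ∈ low cs J, b ^ n * v = 0 := by
      intro v hv
      unfold low at hv
      induction hv using Submodule.span_induction with
      | mem x hx =>
        obtain ⟨K, hK, rfl⟩ := hx
        apply ih
        have := Finset.card_lt_card hK
        omega
      | zero => simp
      | add x y _ _ hx hy => rw [mul_add, hx, hy, add_zero]
      | smul c x _ hx => rw [mul_smul_comm, hx, smul_zero]
    exact h _ (hb J)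

theorem surj (A' : Subalgebra ℚ (MonoidAlgebra ℚ W))
    (hA' : ∀ a ∈ A', a ∈ Submodule.span ℚ (Set.range (descentBasis cs)))
    (t : Finset B → (A' →ₐ[ℚ] ℚ))
    (ht : ∀ J, ∀ a : A', (a : MonoidAlgebra ℚ W) * descentBasis cs J -
      (t J a) • descentBasis cs J ∈ low cs J) : Function.Surjective t := by
  intro χ
  by_contra hne
  push Not at hne
  have hex : ∀ J, ∃ a : A', t J a ≠ χ a := by
    intro J
    by_contra h
    push Not at h
    exact hne J (AlgHom.ext h)
  choose a ha using hex
  let g : Finset B → A' := fun J => a J - algebraMap ℚ A' (t J (a J))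
  let b : A' := ((Finset.univ : Finset (Finset B)).toList.map g).prod
  have htb : ∀ J, t J b = 0 := by
    intro J
    change t J (List.prod _) = 0
    rw [map_list_prod, List.prod_eq_zero_iff, List.map_map, List.mem_map]
    refine ⟨J, by simp, ?_⟩
    simp [g]
  have hχ : χ b ≠ 0 := by
    change χ (List.prod _) ≠ 0
    rw [map_list_prod, Ne, List.prod_eq_zero_iff, List.map_map, List.mem_map]
    rintro ⟨J, _, h⟩
    simp only [g, Function.comp, map_sub, AlgHom.commutes] at h
    apply ha J
    simpa [eq_comm] using sub_eq_zero.mp h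
  have hz := nilp cs (b : MonoidAlgebra ℚ W)
    (fun J v hv => span_mul_low cs J _ v (hA' b b.2) hv)
    (fun J => by have := ht J b; rwa [htb, zero_smul, sub_zero] at this)
    _ Finset.univ (Nat.lt_succ_self _)
  rw [basis_univ, mul_one] at hz
  have hz' : b ^ ((Finset.univ : Finset B).card + 1) = 0 := by
    apply Subtype.ext
    push_cast
    exact hz
  have := congrArg χ hz'
  rw [map_pow, map_zero] at this
  exact hχ (pow_eq_zero_iff (by omega) |>.mp this)

theorem mfix_conj (I J K : Finset B) (w : W)
    (h : parabolic cs K = Subgroup.map (MulAut.conj w).toMonoidHom (parabolic cs J)) :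
    mfix cs I J = mfix cs I K := by
  unfold mfix
  refine Nat.card_congr ((MulAction.toPerm w).subtypeEquiv fun F => ?_)
  rw [h]
  constructor
  · rintro hF _ ⟨x, hx, rfl⟩
    change (w * x * w⁻¹) • w • F = w • F
    rw [smul_smul, inv_mul_cancel_right, mul_smul, hF x hx]
  · intro hF x hx
    have : (w * x * w⁻¹) • w • F = w • F := hF _ ⟨x, hx, rfl⟩
    rw [smul_smul, inv_mul_cancel_right, mul_smul] at this
    exact MulAction.injective w this

theorem mfix_self_pos (J : Finset B) : 0 < mfix cs J J := by
  unfold mfix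
  rw [Nat.card_pos_iff]
  refine ⟨⟨⟨QuotientGroup.mk 1, fun x hx => ?_⟩⟩, inferInstance⟩
  rw [smul_mk_eq_iff]
  simpa using hx

theorem of_mfix_pos (I J : Finset B) (h : mfix cs I J ≠ 0) :
    ∃ g : W, parabolic cs J ≤ Subgroup.map (MulAut.conj g).toMonoidHom (parabolic cs I) := by
  unfold mfix at h
  have h' := Nat.pos_of_ne_zero h
  rw [Nat.card_pos_iff] at h'
  obtain ⟨⟨⟨F, hF⟩⟩, _⟩ := h'
  obtain ⟨c, rfl⟩ := QuotientGroup.mk_surjective F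
  refine ⟨c, fun x hx => ?_⟩
  have := (smul_mk_eq_iff cs I x c).mp (hF x hx)
  refine ⟨_, this, ?_⟩
  change c * (c⁻¹ * x * c) * c⁻¹ = x
  group

section sigma

variable (σ : W ≃* W) (e : B ≃ B) (he : ∀ i : B, σ (cs.simple i) = cs.simple (e i))

theorem sigma_wordProd (he : ∀ i : B, σ (cs.simple i) = cs.simple (e i)) (ω : List B) :
    σ (cs.wordProd ω) = cs.wordProd (ω.map e) := by
  induction ω with
  | nil => simp
  | cons i ω ih => simp [CoxeterSystem.wordProd_cons, ih, he]

theorem sigma_length_le (he : ∀ i : B, σ (cs.simple i) = cs.simple (e i)) (w : W) :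
    cs.length (σ w) ≤ cs.length w := by
  obtain ⟨ω, hω, rfl⟩ := cs.exists_isReduced w
  rw [sigma_wordProd cs σ e he]
  refine (cs.length_wordProd_le _).trans ?_
  rw [List.length_map]
  exact le_of_eq (Eq.symm hω)

theorem sigma_length (he : ∀ i : B, σ (cs.simple i) = cs.simple (e i)) (w : W) :
    cs.length (σ w) = cs.length w := by
  apply le_antisymm (sigma_length_le cs σ e he w)
  have := sigma_length_le cs σ.symm e.symm (fun i => by
    rw [MulEquiv.symm_apply_eq, he, Equiv.apply_symm_apply]) (σ w)
  simpa using this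

theorem sigma_basis (he : ∀ i : B, σ (cs.simple i) = cs.simple (e i)) (J : Finset B) :
    MonoidAlgebra.domCongr ℚ ℚ σ (descentBasis cs J) = descentBasis cs (J.image e) := by
  unfold descentBasis
  rw [map_sum]
  refine Fintype.sum_equiv σ.toEquiv _ _ fun w => ?_
  have : (∀ i ∈ J.image e, cs.length (σ w) < cs.length (σ w * cs.simple i)) ↔
      ∀ i ∈ J, cs.length w < cs.length (w * cs.simple i) := by
    rw [Finset.forall_mem_image]
    refine forall₂_congr fun i _ => ?_
    rw [← he, ← map_mul, sigma_length cs σ e he, sigma_length cs σ e he]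
  change _ = if (∀ i ∈ J.image e, cs.length (σ w) < cs.length (σ w * cs.simple i)) then
    MonoidAlgebra.single (σ w) (1 : ℚ) else 0
  simp only [this]
  split_ifs
  · rw [MonoidAlgebra.domCongr_single]
  · simp

theorem sigma_low (he : ∀ i : B, σ (cs.simple i) = cs.simple (e i)) (J : Finset B)
    (v : MonoidAlgebra ℚ W) (hv : v ∈ low cs J) :
    MonoidAlgebra.domCongr ℚ ℚ σ v ∈ low cs (J.image e) := by
  unfold low at hv
  induction hv using Submodule.span_induction with
  | mem x hx =>
    obtain ⟨K, hK, rfl⟩ := hx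
    rw [sigma_basis cs σ e he]
    apply basis_mem_low
    exact (Finset.image_ssubset_image e.injective).mpr hK
  | zero => simp
  | add x y _ _ hx hy => rw [map_add]; exact Submodule.add_mem _ hx hy
  | smul c x _ hx => rw [map_smul]; exact Submodule.smul_mem _ _ hx

theorem sigma_eig (he : ∀ i : B, σ (cs.simple i) = cs.simple (e i)) (J : Finset B)
    (a : MonoidAlgebra ℚ W) (ha : MonoidAlgebra.domCongr ℚ ℚ σ a = a) (c : ℚ)
    (h : a * descentBasis cs J - c • descentBasis cs J ∈ low cs J) :
    a * descentBasis cs (J.image e) - c • descentBasis cs (J.image e) ∈ low cs (J.image e) := by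
  have := sigma_low cs σ e he J _ h
  rwa [map_sub, map_mul, map_smul, ha, sigma_basis cs σ e he] at this

theorem sigma_card (he : ∀ i : B, σ (cs.simple i) = cs.simple (e i)) (J : Finset B) :
    Nat.card (parabolic cs (J.image e)) = Nat.card (parabolic cs J) := by
  have : parabolic cs (J.image e) = (parabolic cs J).map σ.toMonoidHom := by
    unfold parabolic
    rw [MonoidHom.map_closure, Finset.coe_image, Set.image_image, Set.image_image]
    congr 1
    refine Set.image_congr fun i _ => ?_
    exact (he i).symm
  rw [this]
  exact Nat.card_congr ((parabolic cs J).equivMapOfInjective _ σ.injective).symm.toEquiv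

theorem sigma_card_iter (he : ∀ i : B, σ (cs.simple i) = cs.simple (e i)) (J : Finset B) (n : ℕ) :
    Nat.card (parabolic cs ((fun L : Finset B => L.image e)^[n] J)) =
      Nat.card (parabolic cs J) := by
  induction n with
  | zero => rfl
  | succ n ih => rw [Function.iterate_succ_apply', sigma_card cs σ e he, ih]

theorem image_iter (e : B ≃ B) (J : Finset B) (n : ℕ) :
    (fun L : Finset B => L.image e)^[n] J = J.image ((e : Equiv.Perm B) ^ n : Equiv.Perm B) := by
  induction n with
  | zero => simp
  | succ n ih =>
    rw [Function.iterate_succ_apply', ih, Finset.image_image, pow_succ']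
    rfl

/-- orbit sum -/
noncomputable def osum (J : Finset B) : MonoidAlgebra ℚ W :=
  ∑ n ∈ Finset.range (orderOf (e : Equiv.Perm B)),
    descentBasis cs ((fun L : Finset B => L.image e)^[n] J)

theorem osum_fixed (he : ∀ i : B, σ (cs.simple i) = cs.simple (e i)) (J : Finset B) :
    MonoidAlgebra.domCongr ℚ ℚ σ (osum cs e J) = osum cs e J := by
  unfold osum
  rw [map_sum]
  simp only [sigma_basis cs σ e he]
  have h1 := Finset.sum_range_succ (fun n => descentBasis cs ((fun L : Finset B => L.image e)^[n] J))
    (orderOf (e : Equiv.Perm B))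
  rw [Finset.sum_range_succ'] at h1
  simp only [Function.iterate_succ_apply', image_iter e J (orderOf (e : Equiv.Perm B)),
    pow_orderOf_eq_one] at h1
  have h2 : (fun L : Finset B => L.image e)^[0] J = J.image ((1 : Equiv.Perm B)) := by simp
  rw [h2] at h1
  exact add_right_cancel h1

theorem osum_eig (J K : Finset B) :
    osum cs e J * descentBasis cs K -
      ((∑ n ∈ Finset.range (orderOf (e : Equiv.Perm B)),
        mfix cs ((fun L : Finset B => L.image e)^[n] J) K : ℕ) : ℚ) • descentBasis cs K ∈
      low cs K := by
  unfold osum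
  rw [Finset.sum_mul, Nat.cast_sum, Finset.sum_smul, ← Finset.sum_sub_distrib]
  exact Submodule.sum_mem _ fun n _ => mul_basis_sub cs _ K

theorem osum_self (J : Finset B) :
    0 < ∑ n ∈ Finset.range (orderOf (e : Equiv.Perm B)),
        mfix cs ((fun L : Finset B => L.image e)^[n] J) J := by
  refine lt_of_lt_of_le (mfix_self_pos cs J) ?_
  have h := orderOf_pos (e : Equiv.Perm B)
  obtain ⟨N, hN⟩ := Nat.exists_eq_succ_of_ne_zero h.ne'
  rw [hN, Nat.succ_eq_add_one, Finset.sum_range_succ', Function.iterate_zero_apply]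
  exact Nat.le_add_left _ _

theorem osum_mem (J : Finset B) :
    osum cs e J ∈ Submodule.span ℚ (Set.range (descentBasis cs)) :=
  Submodule.sum_mem _ fun _ _ => Submodule.subset_span ⟨_, rfl⟩

end sigma

theorem card_conj (w : W) (H : Subgroup W) :
    Nat.card (H.map (MulAut.conj w).toMonoidHom) = Nat.card H :=
  Nat.card_congr (H.equivMapOfInjective _ (MulAut.conj w).injective).symm.toEquiv

end product

end DescAux

set_option synthInstance.maxHeartbeats 1000000 in
set_option maxHeartbeats 1000000 in
/-- The irreducible characters of `Σ(W)^σ` are naturally parametrized by the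
`σ`-orbits on the set `Λ` of `W`-conjugacy classes of subsets of `S`: there is a
family `t J` (`J ⊆ S`) of `ℚ`-algebra homomorphisms `Σ(W)^σ → ℚ`, where `t J` is the
restriction to `Σ(W)^σ` of the character `τ_{λ(J)}` (characterized by the eigenvalue
property `x·x_J ≡ (t J x)·x_J` modulo the span of the `x_K`, `K ⊊ J`), such that
`t J = t K` iff `J` and `K` are conjugate up to the action of `σ`, and every
irreducible character of `Σ(W)^σ` (i.e. every `ℚ`-algebra homomorphism to `ℚ`) is of
this form. -/
theorem irr_fixedPoints_descentAlgebra {M : CoxeterMatrix B}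
    (cs : CoxeterSystem M W) (σ : W ≃* W) (e : B ≃ B)
    (he : ∀ i : B, σ (cs.simple i) = cs.simple (e i))
    (A A' : Subalgebra ℚ (MonoidAlgebra ℚ W)) (hA : IsDescentAlgebra cs A)
    (hA' : (A' : Set (MonoidAlgebra ℚ W)) =
      {a | a ∈ A ∧ MonoidAlgebra.domCongr ℚ ℚ σ a = a}) :
    ∃ t : Finset B → (A' →ₐ[ℚ] ℚ),
      (∀ (J : Finset B) (a : A'),
        (a : MonoidAlgebra ℚ W) * descentBasis cs J - (t J a) • descentBasis cs J ∈
          Submodule.span ℚ (descentBasis cs '' {K | K ⊂ J})) ∧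
      (∀ J K : Finset B, t J = t K ↔
        ∃ n : ℕ, ∃ w : W, parabolic cs K =
          Subgroup.map (MulAut.conj w).toMonoidHom
            (parabolic cs ((fun L : Finset B => L.image e)^[n] J))) ∧
      Function.Surjective t := by
  have hmem : ∀ a, a ∈ A ↔ a ∈ Submodule.span ℚ (Set.range (descentBasis cs)) := by
    intro a
    have := Set.ext_iff.mp hA a
    exact this
  have hmem' : ∀ a, a ∈ A' ↔ a ∈ Submodule.span ℚ (Set.range (descentBasis cs)) ∧
      MonoidAlgebra.domCongr ℚ ℚ σ a = a := by
    intro a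
    have h := Set.ext_iff.mp hA' a
    rw [← hmem]
    exact h
  have hsp : ∀ a ∈ A', a ∈ Submodule.span ℚ (Set.range (descentBasis cs)) :=
    fun a ha => ((hmem' a).mp ha).1
  choose t ht using DescAux.exists_hom cs A' hsp
  have hcard : ∀ J K, t J = t K → ∃ n : ℕ, ∃ g : W, parabolic cs K ≤
      Subgroup.map (MulAut.conj g).toMonoidHom
        (parabolic cs ((fun L : Finset B => L.image e)^[n] J)) := by
    intro J K h
    let a : A' := ⟨DescAux.osum cs e J,
      (hmem' _).mpr ⟨DescAux.osum_mem cs e J, DescAux.osum_fixed cs σ e he J⟩⟩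
    have h1 := DescAux.eig_unique cs J _ _ _ (ht J a) (DescAux.osum_eig cs e J J)
    have h2 := DescAux.eig_unique cs K _ _ _ (ht K a) (DescAux.osum_eig cs e J K)
    rw [h, h2] at h1
    have h3 := Nat.cast_injective h1
    have h4 := DescAux.osum_self cs e J
    rw [← h3] at h4
    obtain ⟨n, _, hn⟩ := Finset.exists_ne_zero_of_sum_ne_zero h4.ne'
    obtain ⟨g, hg⟩ := DescAux.of_mfix_pos cs _ _ hn
    exact ⟨n, g, hg⟩
  have hle : ∀ J K, t J = t K → Nat.card (parabolic cs K) ≤ Nat.card (parabolic cs J) := by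
    intro J K h
    obtain ⟨n, g, hg⟩ := hcard J K h
    have := Subgroup.card_le_of_le hg
    rwa [DescAux.card_conj, DescAux.sigma_card_iter cs σ e he] at this
  refine ⟨t, ht, fun J K => ⟨fun h => ?_, ?_⟩, DescAux.surj cs A' hsp t ht⟩
  · obtain ⟨n, g, hg⟩ := hcard J K h
    refine ⟨n, g, Subgroup.eq_of_le_of_card_ge hg ?_⟩
    rw [DescAux.card_conj, DescAux.sigma_card_iter cs σ e he]
    exact hle K J h.symm
  · rintro ⟨n, w, h⟩
    have h1 : ∀ n, t J = t ((fun L : Finset B => L.image e)^[n] J) := by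
      intro n
      induction n with
      | zero => rfl
      | succ n ih =>
        rw [ih, Function.iterate_succ_apply']
        refine AlgHom.ext fun a => ?_
        exact DescAux.eig_unique cs _ _ _ _
          (DescAux.sigma_eig cs σ e he _ a ((hmem' a).mp a.2).2 _ (ht _ a)) (ht _ a)
    rw [h1 n]
    refine AlgHom.ext fun a => ?_
    obtain ⟨c, hc1, hc2⟩ := DescAux.exists_eig cs _ K
      (fun I => DescAux.mfix_conj cs I _ K w h) a (hsp a a.2)
    rw [DescAux.eig_unique cs _ _ _ _ (ht _ a) hc1, DescAux.eig_unique cs _ _ _ _ (ht _ a) hc2]
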